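/- arXiv:2410.06421 — 3 statements merged into one kernel-verified Lean document; each statement's English description precedes it below -/
import Mathlib

section
/- For every fixed ε ∈ (0, 1/2) and every sequence p = p(n) ∈ [0,1] with n·p(n) → ∞, w.h.p. the random graph G = G_{n,p(n)} on vertex set [n] has the following property: every spanning subgraph H' of G in which every vertex has degree greater than (1−ε)·n·p(n)/2 has all of its connected components of order at least (1−2ε)·n/2. -/
open Finset SimpleGraph Filter Topology

noncomputable section
open scoped Classical

namespace RG

variable {α β V : Type*}

/-- The number of edges of a graph. -/
def eCount (H : SimpleGraph α) : ℕ := Nat.card ↥H.edgeSet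

/-- The number of automorphisms of a graph. -/
def autCount (H : SimpleGraph α) : ℕ := Nat.card (H ≃g H)

/-- Every vertex has even degree. -/
def IsEulerianGraph (H : SimpleGraph α) : Prop :=
  ∀ v, Even (Nat.card ↥(H.neighborSet v))

/-- Vectors in the ambient 𝔽₂ edge space on the vertex type `V`. -/
abbrev EdgeVec (V : Type*) := Sym2 V → ZMod 2

/-- Indicator vector of a set of edges. -/
def setVec (s : Set (Sym2 V)) : EdgeVec V := fun e => if e ∈ s then 1 else 0

/-- The support (set of edges) of an edge-space vector. -/
def suppSet (f : EdgeVec V) : Set (Sym2 V) := {e | f e ≠ 0}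

/-- The number of edges of an edge-space vector. -/
def wt (f : EdgeVec V) : ℕ := Nat.card ↥(suppSet f)

/-- The edge space `E(G)`: the span of the indicators of single edges of `G`,
i.e. all vectors supported on `E(G)`. -/
def edgeSpace (G : SimpleGraph V) : Submodule (ZMod 2) (EdgeVec V) :=
  Submodule.span (ZMod 2) {f | ∃ e ∈ G.edgeSet, f = setVec {e}}

/-- The mod-2 degree of the vertex `v` in an edge-space vector. -/
def parityMap [Fintype V] [DecidableEq V] (v : V) : EdgeVec V →ₗ[ZMod 2] ZMod 2 where
  toFun f := ∑ w ∈ Finset.univ.erase v, f s(v, w)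
  map_add' f g := by simp [Finset.sum_add_distrib]
  map_smul' c f := by simp [Finset.mul_sum, mul_sub]

/-- The cycle space `C(G)`: members of `E(G)` in which every vertex has even degree. -/
def cycleSpace [Fintype V] [DecidableEq V] (G : SimpleGraph V) :
    Submodule (ZMod 2) (EdgeVec V) :=
  edgeSpace G ⊓ ⨅ v : V, LinearMap.ker (parityMap v)

/-- The mod-2 total number of edges of an edge-space vector. -/
def totalMap [Fintype V] [DecidableEq V] : EdgeVec V →ₗ[ZMod 2] ZMod 2 where
  toFun f := ∑ e, f e
  map_add' f g := by simp [Finset.sum_add_distrib]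
  map_smul' c f := by simp [Finset.mul_sum, mul_sub]

/-- The space `D(G)` of even-size members of `E(G)`. -/
def dSpace [Fintype V] [DecidableEq V] (G : SimpleGraph V) :
    Submodule (ZMod 2) (EdgeVec V) :=
  edgeSpace G ⊓ LinearMap.ker (totalMap (V := V))

/-- The `H`-space `C_H(G)`: the span of the (indicators of the edge sets of) copies of `H`
in `G`. -/
def hSpace (H : SimpleGraph α) (G : SimpleGraph V) : Submodule (ZMod 2) (EdgeVec V) :=
  Submodule.span (ZMod 2)
    {f | ∃ K : G.Subgraph, Nonempty (H ≃g K.coe) ∧ f = setVec K.edgeSet}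

/-- `W_H(G)`, the natural candidate value of `C_H(G)`. -/
def wSpace [Fintype V] [DecidableEq V] (H : SimpleGraph α) (G : SimpleGraph V) :
    Submodule (ZMod 2) (EdgeVec V) :=
  if IsEulerianGraph H then
    if Odd (eCount H) then cycleSpace G else cycleSpace G ⊓ dSpace G
  else
    if Odd (eCount H) then edgeSpace G else dSpace G

/-- `G ∈ T_H` : the `H`-space equals its natural value. -/
def memT [Fintype V] [DecidableEq V] (H : SimpleGraph α) (G : SimpleGraph V) : Prop :=
  hSpace H G = wSpace H G

/-- `G ∈ Q_H` : every edge of `G` lies in a copy of `H`. -/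
def memQ (H : SimpleGraph α) (G : SimpleGraph V) : Prop :=
  ∀ e ∈ G.edgeSet, ∃ K : G.Subgraph, Nonempty (H ≃g K.coe) ∧ e ∈ K.edgeSet

/-- The standard 𝔽₂ inner product `⟨f,g⟩ = |f ∩ g| mod 2`. -/
def ip [Fintype V] [DecidableEq V] (f g : EdgeVec V) : ZMod 2 := ∑ e, f e * g e

/-- The orthogonal complement of `S` inside the edge space of `G`. -/
def perpIn [Fintype V] [DecidableEq V] (G : SimpleGraph V)
    (S : Submodule (ZMod 2) (EdgeVec V)) : Set (EdgeVec V) :=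
  {f | f ∈ edgeSpace G ∧ ∀ g ∈ S, ip f g = 0}

/-- The probability that the Erdős–Rényi random graph `G_{n,p}` lies in the set `A`. -/
def erProb (n : ℕ) (p : ℝ) (A : Set (SimpleGraph (Fin n))) : ℝ :=
  ∑ s ∈ (⊤ : SimpleGraph (Fin n)).edgeFinset.powerset,
    if SimpleGraph.fromEdgeSet (↑s) ∈ A then
      p ^ s.card * (1 - p) ^ ((⊤ : SimpleGraph (Fin n)).edgeFinset.card - s.card)
    else 0

/-- `(e-1)/(v-2)` when `v ≥ 3`, and `0` otherwise. -/
def density2 (v e : ℕ) : ℝ := if 3 ≤ v then ((e : ℝ) - 1) / ((v : ℝ) - 2) else 0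

/-- The 2-density `d₂(H)`. -/
def d2 (H : SimpleGraph α) : ℝ := density2 (Nat.card α) (eCount H)

/-- The 2-density of a subgraph. -/
def subDensity2 {H : SimpleGraph α} (K : H.Subgraph) : ℝ :=
  density2 (Nat.card ↥K.verts) (Nat.card ↥K.edgeSet)

/-- The maximum 2-density `m₂(H)`. -/
def m2 (H : SimpleGraph α) : ℝ := sSup {x : ℝ | ∃ K : H.Subgraph, x = subDensity2 K}

/-- `H` is strictly 2-balanced. -/
def Strictly2Balanced (H : SimpleGraph α) : Prop :=
  3 ≤ Nat.card α ∧ ∀ K : H.Subgraph, K ≠ ⊤ → subDensity2 K < d2 H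

/-- `ϱ(H) = Σ_{(a,b)} 1/aut(H;a,b) = 2·e_H/aut(H)`. -/
def rho (H : SimpleGraph α) : ℝ := 2 * (eCount H : ℝ) / (autCount H : ℝ)

/-- The sharp threshold `p*_H(n)` for `Q_H`. -/
def pStar (H : SimpleGraph α) (n : ℕ) : ℝ :=
  (n : ℝ) ^ (-(1 / m2 H)) *
    ((2 - 1 / m2 H) * (rho H)⁻¹ * Real.log n) ^ (1 / ((eCount H : ℝ) - 1))

/-- `Λ^p = ϱ(H)·(n-2)_{v_H-2}·p^{e_H-1}`, the expected number of copies of `H` on a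
fixed edge. -/
def Lambda (H : SimpleGraph α) (n : ℕ) (p : ℝ) : ℝ :=
  rho H * ((n - 2).descFactorial (Nat.card α - 2) : ℝ) * p ^ (eCount H - 1)

/-- `H` is isomorphic neither to the two-edge path nor to the triangle. -/
def NotPathOrTriangle (H : SimpleGraph α) : Prop :=
  ¬ Nonempty (H ≃g SimpleGraph.pathGraph 3) ∧ ¬ Nonempty (H ≃g (⊤ : SimpleGraph (Fin 3)))

/-! ### Bridges -/

/-- `G` together with the edge `xy`. -/
def bridgeHost (G : SimpleGraph V) (x y : V) : SimpleGraph V :=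
  G ⊔ SimpleGraph.fromEdgeSet {s(x, y)}

/-- A copy of `H` in `G ∪ {xy}` containing the edge `xy`; such copies correspond to the
`xy`-bridges `K - xy` of `G`. -/
def IsBridgeCopy (H : SimpleGraph α) (G : SimpleGraph V) (x y : V)
    (K : (bridgeHost G x y).Subgraph) : Prop :=
  Nonempty (H ≃g K.coe) ∧ s(x, y) ∈ K.edgeSet

/-- `τ_G(x,y)`: the number of `xy`-bridges in `G`. -/
def tauB (H : SimpleGraph α) (G : SimpleGraph V) (x y : V) : ℕ :=
  Nat.card {K : (bridgeHost G x y).Subgraph // IsBridgeCopy H G x y K}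

/-- `σ_G(x,y)`: the maximum size of a family of internally disjoint `xy`-bridges in `G`. -/
def sigmaB (H : SimpleGraph α) (G : SimpleGraph V) (x y : V) : ℕ :=
  sSup {m | ∃ T : Finset ((bridgeHost G x y).Subgraph),
    (∀ K ∈ T, IsBridgeCopy H G x y K) ∧
    (∀ K ∈ T, ∀ K' ∈ T, K ≠ K' → (K.verts ∩ K'.verts : Set V) ⊆ {x, y}) ∧ T.card = m}

/-- An `S`-central `xy`-bridge: the bridge contains an odd number of edges of `S`, at
least one of which misses `{x,y}`. -/
def IsCentralBridge (H : SimpleGraph α) (G : SimpleGraph V) (S : Set (Sym2 V)) (x y : V)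
    (K : (bridgeHost G x y).Subgraph) : Prop :=
  IsBridgeCopy H G x y K ∧
  Odd (Nat.card {e : Sym2 V // e ∈ K.edgeSet ∧ e ≠ s(x, y) ∧ e ∈ S}) ∧
  ∃ e ∈ K.edgeSet, e ∈ S ∧ x ∉ e ∧ y ∉ e

/-- `σ_G(xy; S)`: the maximum size of a family of internally disjoint `S`-central
`xy`-bridges in `G`. -/
def sigmaCentral (H : SimpleGraph α) (G : SimpleGraph V) (S : Set (Sym2 V)) (x y : V) : ℕ :=
  sSup {m | ∃ T : Finset ((bridgeHost G x y).Subgraph),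
    (∀ K ∈ T, IsCentralBridge H G S x y K) ∧
    (∀ K ∈ T, ∀ K' ∈ T, K ≠ K' → (K.verts ∩ K'.verts : Set V) ⊆ {x, y}) ∧ T.card = m}

/-! ### Extensions `[W,Z]` -/

/-- The adjacency relation of the pair `[W,Z]` in `F`: edges of `F[Z]` which do not lie
inside `W`. -/
def PairAdj (F : SimpleGraph β) (W Z : Set β) (a b : ↥Z) : Prop :=
  F.Adj (a : β) (b : β) ∧ ¬((a : β) ∈ W ∧ (b : β) ∈ W)

/-- `v(W,Z)`: the number of internal vertices of `[W,Z]`. -/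
def vWZ (W Z : Set β) : ℕ := Nat.card ↥(Z \ W)

/-- `e(W,Z)`: the number of edges of `[W,Z]`. -/
def eWZ (F : SimpleGraph β) (W Z : Set β) : ℕ :=
  Nat.card {q : Sym2 β // q ∈ F.edgeSet ∧ (∀ a ∈ q, a ∈ Z) ∧ ¬(∀ a ∈ q, a ∈ W)}

/-- `d(W,Z) = e(W,Z)/v(W,Z)`. -/
def dWZ (F : SimpleGraph β) (W Z : Set β) : ℝ := (eWZ F W Z : ℝ) / (vWZ W Z : ℝ)

/-- `[W,Z]` is strictly balanced. -/
def StrictlyBalancedWZ (F : SimpleGraph β) (W Z : Set β) : Prop :=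
  ∀ Y : Set β, W ⊂ Y → Y ⊂ Z → dWZ F W Y < dWZ F W Z

/-- `m(W,Z) = max{d(W,Y) : W ⊊ Y ⊆ Z}`. -/
def mWZ (F : SimpleGraph β) (W Z : Set β) : ℝ :=
  sSup {x : ℝ | ∃ Y : Set β, W ⊂ Y ∧ Y ⊆ Z ∧ x = dWZ F W Y}

/-- `aut[W,Z]`: the number of automorphisms of `[W,Z]` fixing `W` pointwise. -/
def autWZ (F : SimpleGraph β) (W Z : Set β) : ℕ :=
  Nat.card {γ : ↥Z ≃ ↥Z // (∀ w : ↥Z, (w : β) ∈ W → γ w = w) ∧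
    ∀ a b : ↥Z, PairAdj F W Z a b ↔ PairAdj F W Z (γ a) (γ b)}

/-- `μ_p(W,Z) = n^{v(W,Z)}·p^{e(W,Z)}/aut[W,Z]`. -/
def muWZ (F : SimpleGraph β) (W Z : Set β) (n : ℕ) (p : ℝ) : ℝ :=
  (n : ℝ) ^ (vWZ W Z) * p ^ (eWZ F W Z) / (autWZ F W Z : ℝ)

/-- A `[W,Z]`-extension on the tuple `x` in `G`. -/
def IsExt (F : SimpleGraph β) (W Z : Set β) (G : SimpleGraph V) (x : ↥W → V)
    (ψ : ↥Z → V) : Prop :=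
  Function.Injective ψ ∧
  (∀ (w : ↥Z) (hw : (w : β) ∈ W), ψ w = x ⟨(w : β), hw⟩) ∧
  ∀ a b : ↥Z, PairAdj F W Z a b → G.Adj (ψ a) (ψ b)

/-- The data (internal vertex image, edge image) of an extension; two extensions are
equivalent (give the same copy) iff they have the same data. -/
def extData (F : SimpleGraph β) (W Z : Set β) (ψ : ↥Z → V) : Set V × Set (Sym2 V) :=
  (ψ '' {z : ↥Z | (z : β) ∉ W},
   {q | ∃ a b : ↥Z, PairAdj F W Z a b ∧ q = s(ψ a, ψ b)})

/-- The set of copies of `[W,Z]` on `x` in `G`. -/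
def copySet (F : SimpleGraph β) (W Z : Set β) (G : SimpleGraph V) (x : ↥W → V) :
    Set (Set V × Set (Sym2 V)) :=
  {d | ∃ ψ : ↥Z → V, IsExt F W Z G x ψ ∧ extData F W Z ψ = d}

/-- `τ_{[W,Z]}(G,X)`: the number of copies of `[W,Z]` on `x` in `G`. -/
def tauExt (F : SimpleGraph β) (W Z : Set β) (G : SimpleGraph V) (x : ↥W → V) : ℕ :=
  Nat.card ↥(copySet F W Z G x)

/-- `σ_{[W,Z]}(G,X)`: the maximum size of a family of internally disjoint copies of
`[W,Z]` on `x` in `G`. -/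
def sigmaExt (F : SimpleGraph β) (W Z : Set β) (G : SimpleGraph V) (x : ↥W → V) : ℕ :=
  sSup {m | ∃ T : Finset (Set V × Set (Sym2 V)),
    (↑T : Set (Set V × Set (Sym2 V))) ⊆ copySet F W Z G x ∧
    (∀ d ∈ T, ∀ d' ∈ T, d ≠ d' → d.1 ∩ d'.1 = ∅) ∧ T.card = m}

/-- `φ(x) = (1+x)log(1+x) - x` for `x > -1`, with `φ(-1) = 1`. -/
def phiFn (x : ℝ) : ℝ := if x = -1 then 1 else (1 + x) * Real.log (1 + x) - x



/-! ### Helper lemmas for the proof -/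

lemma aux_mgf {ι : Type*} [DecidableEq ι] (E F : Finset ι) (hF : F ⊆ E) (p x : ℝ) :
    ∑ s ∈ E.powerset, p ^ s.card * (1 - p) ^ (E.card - s.card) * x ^ (s ∩ F).card
      = (1 + p * (x - 1)) ^ F.card := by
  have h := Finset.prod_add (fun i => p * (if i ∈ F then x else 1)) (fun _ => 1 - p) E
  have h2 : ∏ i ∈ E, (p * (if i ∈ F then x else 1) + (1 - p)) = (1 + p * (x - 1)) ^ F.card := by
    have : ∀ i ∈ E, (p * (if i ∈ F then x else 1) + (1 - p))
        = if i ∈ F then (1 + p * (x - 1)) else 1 := by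
      intro i _
      split_ifs <;> ring
    rw [Finset.prod_congr rfl this, Finset.prod_ite_mem, Finset.prod_const,
      Finset.inter_eq_right.mpr hF]
  rw [← h2, h]
  refine Finset.sum_congr rfl fun s hs => ?_
  rw [Finset.mem_powerset] at hs
  rw [Finset.prod_mul_distrib, Finset.prod_const, Finset.prod_const, Finset.prod_ite_mem,
    Finset.prod_const, Finset.card_sdiff_of_subset hs]
  ring

/-- The potential edges inside `W`. -/
def auxE {n : ℕ} (W : Finset (Fin n)) : Finset (Sym2 (Fin n)) :=
  W.offDiag.image (fun a => s(a.1, a.2))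

lemma auxE_subset {n : ℕ} (W : Finset (Fin n)) :
    auxE W ⊆ (⊤ : SimpleGraph (Fin n)).edgeFinset := by
  intro e he
  simp only [auxE, Finset.mem_image, Finset.mem_offDiag] at he
  obtain ⟨a, ⟨_, _, h⟩, rfl⟩ := he
  simpa using h

lemma auxE_card {n : ℕ} (W : Finset (Fin n)) :
    ((auxE W).card : ℝ) ≤ (W.card : ℝ) ^ 2 / 2 := by
  have h : (auxE W).card = W.card.choose 2 := by
    have := Sym2.card_image_offDiag W
    convert this using 2
    ext e
    simp [auxE, Function.uncurry]
  rw [h, Nat.cast_choose_two]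
  have : (0:ℝ) ≤ W.card := by positivity
  nlinarith

/-- A component of small order forces many edges inside it. -/
lemma aux_det {n : ℕ} (s : Finset (Sym2 (Fin n))) (H : SimpleGraph (Fin n))
    (hH : H ≤ SimpleGraph.fromEdgeSet (↑s)) (d : ℝ)
    (hd : ∀ v, d < (Nat.card ↥(H.neighborSet v) : ℝ)) (v : Fin n) (W : Finset (Fin n))
    (hW : ∀ w, w ∈ W ↔ H.Reachable v w) :
    (W.card : ℝ) * d / 2 ≤ ((s ∩ auxE W).card : ℝ) := by
  set P : Finset (Fin n × Fin n) := Finset.univ.filter (fun a => a.1 ∈ W ∧ H.Adj a.1 a.2) with hP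
  have h1 : (W.card : ℝ) * d ≤ (P.card : ℝ) := by
    have hc : P.card = ∑ w ∈ W, (P.filter (fun a => a.1 = w)).card :=
      Finset.card_eq_sum_card_fiberwise (fun a ha => by
        simp only [hP, Finset.coe_filter, Set.mem_setOf_eq] at ha
        exact ha.2.1)
    rw [hc, Nat.cast_sum, ← nsmul_eq_mul]
    refine Finset.card_nsmul_le_sum _ _ _ fun w hw => ?_
    refine (hd w).le.trans ?_
    rw [Nat.cast_le, Nat.card_eq_fintype_card, ← Set.toFinset_card]
    refine Finset.card_le_card_of_injOn (fun u => (w, u)) ?_ ?_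
    · intro u hu
      simp only [Set.coe_toFinset, SimpleGraph.mem_neighborSet] at hu
      simp [hP, hw, hu]
    · intro a _ b _ h
      simpa using h
  have h2 : P.card ≤ 2 * (P.image (fun a => s(a.1, a.2))).card := by
    refine Finset.card_le_mul_card_image P 2 ?_
    intro e _
    induction e with
    | _ x y =>
      refine (Finset.card_le_card (t := {(x, y), (y, x)}) ?_).trans Finset.card_le_two
      rintro ⟨a, b⟩ h
      simp only [Finset.mem_filter, Sym2.eq_iff] at h
      simp only [Finset.mem_insert, Finset.mem_singleton, Prod.mk.injEq]
      exact h.2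
  have h3 : P.image (fun a => s(a.1, a.2)) ⊆ s ∩ auxE W := by
    intro e he
    simp only [Finset.mem_image, hP, Finset.mem_filter] at he
    obtain ⟨⟨a, b⟩, ⟨_, ha, hab⟩, rfl⟩ := he
    have h4 := hH hab
    rw [SimpleGraph.fromEdgeSet_adj] at h4
    refine Finset.mem_inter.mpr ⟨by simpa using h4.1, ?_⟩
    refine Finset.mem_image.mpr ⟨(a, b), ?_, rfl⟩
    refine Finset.mem_offDiag.mpr ⟨ha, ?_, h4.2⟩
    exact (hW b).mpr (((hW a).mp ha).trans hab.reachable)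
  have h5 := Finset.card_le_card h3
  have h6 : (P.card : ℝ) ≤ 2 * ((s ∩ auxE W).card : ℝ) := by
    exact_mod_cast h2.trans (by omega)
  linarith

lemma aux_h (L₀ : ℝ) (h0 : 0 < L₀) :
    ∃ c : ℝ, 0 < c ∧ ∀ L, L₀ ≤ L → c * (1 + L) ≤ L - 1 + Real.exp (-L) := by
  have hp : 0 < L₀ - 1 + Real.exp (-L₀) := by
    have := Real.add_one_lt_exp (x := -L₀) (by linarith)
    linarith
  have hq : 0 < 1 - Real.exp (-L₀) := by
    have := Real.exp_lt_exp.mpr (show -L₀ < 0 by linarith)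
    rw [Real.exp_zero] at this
    linarith
  refine ⟨min ((L₀ - 1 + Real.exp (-L₀)) / (1 + L₀)) (1 - Real.exp (-L₀)),
    lt_min (by positivity) hq, fun L hL => ?_⟩
  set c := min ((L₀ - 1 + Real.exp (-L₀)) / (1 + L₀)) (1 - Real.exp (-L₀))
  have h1 : c * (1 + L₀) ≤ L₀ - 1 + Real.exp (-L₀) := by
    rw [← le_div_iff₀ (by linarith)]
    exact min_le_left _ _
  have h2 : c * (L - L₀) ≤ (1 - Real.exp (-L₀)) * (L - L₀) :=
    mul_le_mul_of_nonneg_right (min_le_right _ _) (by linarith)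
  have h3 : Real.exp (-L₀) * (1 - (L - L₀)) ≤ Real.exp (-L) := by
    have := Real.add_one_le_exp (-(L - L₀))
    have h4 : Real.exp (-L) = Real.exp (-L₀) * Real.exp (-(L - L₀)) := by
      rw [← Real.exp_add]; congr 1; ring
    rw [h4]
    exact mul_le_mul_of_nonneg_left (by linarith) (Real.exp_pos _).le
  nlinarith

lemma aux_choose (n w : ℕ) (hw : 0 < w) (hn : 0 < n) :
    ((n.choose w : ℕ) : ℝ) ≤ Real.exp (w * (1 + Real.log (n / w))) := by
  have hw' : (0:ℝ) < w := by exact_mod_cast hw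
  have hn' : (0:ℝ) < n := by exact_mod_cast hn
  have h1 : ((n.choose w : ℕ) : ℝ) ≤ (n : ℝ) ^ w / (w.factorial : ℝ) := Nat.choose_le_pow_div w n
  have h2 : (w : ℝ) ^ w / (w.factorial : ℝ) ≤ Real.exp w :=
    Real.pow_div_factorial_le_exp w hw'.le w
  have h3 : Real.exp (w * (1 + Real.log (n / w))) = Real.exp w * ((n : ℝ) / w) ^ w := by
    rw [mul_add, mul_one, Real.exp_add, Real.exp_nat_mul, Real.exp_log (by positivity)]
  rw [h3]
  refine h1.trans ?_
  have h4 : (n : ℝ) ^ w / (w.factorial : ℝ)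
      = (w : ℝ) ^ w / (w.factorial : ℝ) * ((n : ℝ) / w) ^ w := by
    rw [div_pow]
    field_simp
  rw [h4]
  exact mul_le_mul_of_nonneg_right h2 (by positivity)

lemma aux_geom (r : ℝ) (h0 : 0 ≤ r) (h1 : r ≤ 1 / 2) (n : ℕ) :
    ∑ m ∈ Finset.range n, r ^ m ≤ 2 := by
  have h := (summable_geometric_of_lt_one h0 (by linarith)).sum_le_tsum (Finset.range n)
    (fun i _ => by positivity)
  rw [tsum_geometric_of_lt_one h0 (by linarith)] at h
  refine h.trans ?_
  rw [inv_le_comm₀ (by linarith) (by norm_num)]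
  linarith

/-- Sum of a weight over nonempty subsets. -/
lemma aux_union (n : ℕ) (r : ℝ) (h0 : 0 ≤ r) (h1 : r ≤ 1 / 2) (T : Finset (Finset (Fin n)))
    (hT : ∀ W ∈ T, W.Nonempty) :
    ∑ W ∈ T, r ^ W.card / (n.choose W.card : ℝ) ≤ 2 * r := by
  set f : ℕ → ℝ := fun m => if m = 0 then 0 else r ^ m / (n.choose m : ℝ) with hf
  have hf0 : ∀ m, 0 ≤ f m := by
    intro m
    simp only [hf]
    split_ifs <;> positivity
  have e1 : ∑ W ∈ T, r ^ W.card / (n.choose W.card : ℝ) = ∑ W ∈ T, f W.card := by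
    refine Finset.sum_congr rfl fun W hW => ?_
    have := (hT W hW).card_pos
    simp [hf, this.ne']
  have e2 : ∑ W ∈ T, f W.card ≤ ∑ W ∈ (Finset.univ : Finset (Fin n)).powerset, f W.card :=
    Finset.sum_le_sum_of_subset_of_nonneg (fun W _ => by simp) (fun _ _ _ => hf0 _)
  rw [e1]
  refine e2.trans ?_
  rw [Finset.sum_powerset_apply_card, Finset.card_univ, Fintype.card_fin,
    Finset.sum_range_succ']
  have e3 : ∑ k ∈ Finset.range n, n.choose (k + 1) • f (k + 1)
      = r * ∑ k ∈ Finset.range n, r ^ k := by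
    rw [Finset.mul_sum]
    refine Finset.sum_congr rfl fun k hk => ?_
    have : 0 < n.choose (k + 1) := Nat.choose_pos (by simpa [Nat.succ_le_iff] using hk)
    have h' : (0:ℝ) < n.choose (k + 1) := by exact_mod_cast this
    simp only [hf, nsmul_eq_mul, Nat.add_eq_zero_iff, one_ne_zero, and_false, if_false]
    field_simp
    ring
  rw [e3]
  have := mul_le_mul_of_nonneg_left (aux_geom r h0 h1 n) h0
  simp only [hf, if_true, smul_zero, add_zero]
  linarith

/-- Chernoff-type bound for one set. -/
lemma aux_chernoff {n : ℕ} (W : Finset (Fin n)) (p L t : ℝ) (hp : p ∈ Set.Icc (0:ℝ) 1)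
    (hL : 0 ≤ L) (ht : p * (W.card : ℝ) ^ 2 / 2 * Real.exp L = t) :
    ∑ s ∈ (⊤ : SimpleGraph (Fin n)).edgeFinset.powerset,
      p ^ s.card * (1 - p) ^ ((⊤ : SimpleGraph (Fin n)).edgeFinset.card - s.card) *
        Real.exp (L * ((s ∩ auxE W).card - t))
      ≤ Real.exp (-(t * (L - 1 + Real.exp (-L)))) := by
  have h := aux_mgf (⊤ : SimpleGraph (Fin n)).edgeFinset (auxE W) (auxE_subset W) p (Real.exp L)
  have e : ∑ s ∈ (⊤ : SimpleGraph (Fin n)).edgeFinset.powerset,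
      p ^ s.card * (1 - p) ^ ((⊤ : SimpleGraph (Fin n)).edgeFinset.card - s.card) *
        Real.exp (L * ((s ∩ auxE W).card - t))
      = Real.exp (-(L * t)) * (1 + p * (Real.exp L - 1)) ^ (auxE W).card := by
    rw [← h, Finset.mul_sum]
    refine Finset.sum_congr rfl fun s _ => ?_
    have : Real.exp (L * ((s ∩ auxE W).card - t))
        = Real.exp (-(L * t)) * Real.exp L ^ (s ∩ auxE W).card := by
      rw [← Real.exp_nat_mul, ← Real.exp_add]; congr 1; ring
    rw [this]; ring
  rw [e]
  have hK : 0 ≤ Real.exp L - 1 := by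
    have := Real.one_le_exp hL
    linarith
  have hpK : 0 ≤ p * (Real.exp L - 1) := mul_nonneg hp.1 hK
  have h2 : (1 + p * (Real.exp L - 1)) ^ (auxE W).card
      ≤ Real.exp ((W.card : ℝ) ^ 2 / 2 * (p * (Real.exp L - 1))) := by
    calc (1 + p * (Real.exp L - 1)) ^ (auxE W).card
        ≤ Real.exp (p * (Real.exp L - 1)) ^ (auxE W).card := by
          refine pow_le_pow_left₀ (by linarith) ?_ _
          have := Real.add_one_le_exp (p * (Real.exp L - 1))
          linarith
      _ = Real.exp ((auxE W).card * (p * (Real.exp L - 1))) := by rw [Real.exp_nat_mul]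
      _ ≤ _ := Real.exp_le_exp.mpr (mul_le_mul_of_nonneg_right (auxE_card W) hpK)
  refine (mul_le_mul_of_nonneg_left h2 (Real.exp_pos _).le).trans ?_
  rw [← Real.exp_add]
  refine le_of_eq ?_
  congr 1
  have h3 : Real.exp L * Real.exp (-L) = 1 := by rw [← Real.exp_add]; simp
  have h4 : t * Real.exp (-L) = p * (W.card : ℝ) ^ 2 / 2 := by
    rw [← ht, mul_assoc, h3, mul_one]
  have h5 : (W.card : ℝ) ^ 2 / 2 * (p * (Real.exp L - 1)) = t - t * Real.exp (-L) := by
    rw [h4, ← ht]; ring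
  rw [h5]; ring

lemma aux_total (n : ℕ) (p : ℝ) :
    ∑ s ∈ (⊤ : SimpleGraph (Fin n)).edgeFinset.powerset,
      p ^ s.card * (1 - p) ^ ((⊤ : SimpleGraph (Fin n)).edgeFinset.card - s.card) = 1 := by
  have h := aux_mgf (⊤ : SimpleGraph (Fin n)).edgeFinset ∅ (by simp) p 1
  simpa using h

lemma erProb_le_one (n : ℕ) (p : ℝ) (hp : p ∈ Set.Icc (0:ℝ) 1) (A : Set (SimpleGraph (Fin n))) :
    erProb n p A ≤ 1 := by
  rw [← aux_total n p]
  refine Finset.sum_le_sum fun s _ => ?_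
  have h1 := hp.1
  have h2 : 0 ≤ 1 - p := by linarith [hp.2]
  split_ifs
  · exact le_rfl
  · positivity

/-- Union bound. -/
lemma erProb_union (n : ℕ) (p : ℝ) (hp : p ∈ Set.Icc (0:ℝ) 1) (A : Set (SimpleGraph (Fin n)))
    {ι : Type*} (T : Finset ι) (F : ι → Finset (Sym2 (Fin n)) → ℝ) (hF : ∀ i s, 0 ≤ F i s)
    (hA : ∀ s : Finset (Sym2 (Fin n)), SimpleGraph.fromEdgeSet (↑s) ∉ A → ∃ i ∈ T, 1 ≤ F i s) :
    1 - ∑ i ∈ T, ∑ s ∈ (⊤ : SimpleGraph (Fin n)).edgeFinset.powerset,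
      p ^ s.card * (1 - p) ^ ((⊤ : SimpleGraph (Fin n)).edgeFinset.card - s.card) * F i s
      ≤ erProb n p A := by
  refine le_trans (le_of_eq (congrArg (· - _) (aux_total n p).symm)) ?_
  rw [Finset.sum_comm, ← Finset.sum_sub_distrib]
  refine Finset.sum_le_sum fun s _ => ?_
  have h1 := hp.1
  have h2 : 0 ≤ 1 - p := by linarith [hp.2]
  rw [← Finset.mul_sum]
  set q := p ^ s.card * (1 - p) ^ ((⊤ : SimpleGraph (Fin n)).edgeFinset.card - s.card)
  have hq : 0 ≤ q := by positivity
  have hs : 0 ≤ ∑ i ∈ T, F i s := Finset.sum_nonneg fun i _ => hF i s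
  split_ifs with h
  · have := mul_nonneg hq hs
    linarith
  · obtain ⟨i, hi, h1i⟩ := hA s h
    have : F i s ≤ ∑ i ∈ T, F i s := Finset.single_le_sum (fun i _ => hF i s) hi
    nlinarith

/-- The quantitative bound for fixed `n`. -/
lemma aux_main (ε : ℝ) (hε : ε ∈ Set.Ioo (0 : ℝ) (1 / 2)) (c : ℝ) (hc0 : 0 < c)
    (hc : ∀ L, Real.log ((1 - ε) / (1 - 2 * ε)) ≤ L → c * (1 + L) ≤ L - 1 + Real.exp (-L))
    (n : ℕ) (hn : 0 < n) (p : ℝ) (hp : p ∈ Set.Icc (0 : ℝ) 1)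
    (hA : Real.log 2 ≤ (1 - ε) * c / 4 * (n * p) - 3) :
    1 - 2 * Real.exp (-((1 - ε) * c / 4 * (n * p) - 3)) ≤ erProb n p
      {G | ∀ H' : SimpleGraph (Fin n), H' ≤ G →
        (∀ v, (1 - ε) * (n : ℝ) * p / 2 < (Nat.card ↥(H'.neighborSet v) : ℝ)) →
        ∀ v : Fin n, (1 - 2 * ε) * (n : ℝ) / 2 ≤ (Nat.card ↥{w | H'.Reachable v w} : ℝ)} := by
  obtain ⟨he0, he1⟩ := hε
  set A := (1 - ε) * c / 4 * (n * p) - 3 with hAdef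
  have hA0 : 0 ≤ A := (Real.log_nonneg (by norm_num)).trans hA
  have hn' : (0:ℝ) < n := by exact_mod_cast hn
  set T : Finset (Finset (Fin n)) := Finset.univ.filter
    (fun W => W.Nonempty ∧ (W.card : ℝ) < (1 - 2 * ε) * n / 2) with hT
  set L : Finset (Fin n) → ℝ := fun W => Real.log ((1 - ε) * n / (2 * W.card)) with hL
  set t : Finset (Fin n) → ℝ := fun W => (W.card : ℝ) * ((1 - ε) * (n : ℝ) * p / 2) / 2 with ht
  set F : Finset (Fin n) → Finset (Sym2 (Fin n)) → ℝ :=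
    fun W s => Real.exp (L W * ((s ∩ auxE W).card - t W)) with hF
  have hlog0 : 0 < Real.log ((1 - ε) / (1 - 2 * ε)) :=
    Real.log_pos (by rw [lt_div_iff₀ (by linarith)]; linarith)
  have hLT : ∀ W ∈ T, (0:ℝ) < W.card ∧ Real.log ((1 - ε) / (1 - 2 * ε)) ≤ L W := by
    intro W hW
    simp only [hT, Finset.mem_filter] at hW
    have hw : (0:ℝ) < W.card := by exact_mod_cast hW.2.1.card_pos
    refine ⟨hw, Real.log_le_log (div_pos (by linarith) (by linarith)) ?_⟩
    rw [div_le_div_iff₀ (by linarith) (by linarith), mul_assoc]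
    exact mul_le_mul_of_nonneg_left (by linarith [hW.2.2]) (by linarith)
  refine le_trans ?_ (erProb_union n p hp _ T F (fun W s => (Real.exp_pos _).le) ?_)
  · refine sub_le_sub_left ?_ 1
    refine le_trans (Finset.sum_le_sum (g := fun W => (Real.exp (-A)) ^ W.card /
      (n.choose W.card : ℝ)) ?_) (aux_union n _ (Real.exp_pos _).le ?_ T ?_)
    · intro W hW
      obtain ⟨hw, hLW⟩ := hLT W hW
      have hL0 : 0 ≤ L W := hlog0.le.trans hLW
      have hexp : Real.exp (L W) = (1 - ε) * n / (2 * W.card) :=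
        Real.exp_log (div_pos (mul_pos (by linarith) hn') (by linarith))
      refine (aux_chernoff W p (L W) (t W) hp hL0 ?_).trans ?_
      · rw [hexp]; simp only [ht]; field_simp
        try ring
      · have hch : 0 < n.choose W.card := Nat.choose_pos (by simpa using Finset.card_le_univ W)
        have hch' : (0:ℝ) < n.choose W.card := by exact_mod_cast hch
        rw [le_div_iff₀ hch']
        have h1 := aux_choose n W.card (by exact_mod_cast hw) hn
        refine (mul_le_mul_of_nonneg_left h1 (Real.exp_pos _).le).trans ?_
        rw [← Real.exp_nat_mul, ← Real.exp_add, Real.exp_le_exp]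
        have h2 : Real.log (n / W.card) ≤ L W + 2 := by
          have h3 : (n : ℝ) / W.card = ((1 - ε) * n / (2 * W.card)) * (2 / (1 - ε)) := by
            have : (1 - ε) ≠ 0 := by linarith
            field_simp
          have h5 : (0:ℝ) < 2 / (1 - ε) := div_pos (by norm_num) (by linarith)
          rw [h3, Real.log_mul (div_pos (mul_pos (by linarith) hn') (by linarith)).ne' h5.ne']
          have h4 : Real.log (2 / (1 - ε)) ≤ 2 := by
            rw [Real.log_le_iff_le_exp h5]
            have h6 : 2 / (1 - ε) ≤ 4 := by
              rw [div_le_iff₀ (by linarith)]; linarith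
            have h7 := Real.quadratic_le_exp_of_nonneg (x := 2) (by norm_num)
            norm_num at h7
            linarith
          exact add_le_add le_rfl h4
        have ht0 : 0 ≤ t W := by
          simp only [ht]
          have : 0 ≤ (1 - ε) * n * p :=
            mul_nonneg (mul_nonneg (by linarith) hn'.le) hp.1
          positivity
        have h8 := mul_le_mul_of_nonneg_left (hc _ hLW) ht0
        have h9 : t W * (c * (1 + L W)) = W.card * (1 + L W) * (A + 3) := by
          simp only [ht, hAdef]; ring
        have h10 : (W.card : ℝ) * (1 + Real.log (n / W.card)) ≤ W.card * (1 + L W) * 3 := by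
          rw [mul_assoc]
          exact mul_le_mul_of_nonneg_left (by linarith) hw.le
        have h11 : 0 ≤ W.card * L W * A := by positivity
        nlinarith
    · rw [Real.exp_neg, one_div]
      refine inv_anti₀ (by norm_num) ?_
      rw [← Real.log_le_iff_le_exp (by norm_num)]
      exact hA
    · intro W hW
      simp only [hT, Finset.mem_filter] at hW
      exact hW.2.1
  · intro s hs
    simp only [Set.mem_setOf_eq, not_forall, not_le] at hs
    obtain ⟨H, hH, hd, v, hv⟩ := hs
    set W : Finset (Fin n) := Finset.univ.filter (fun w => H.Reachable v w) with hW
    have hcard : Nat.card ↥{w | H.Reachable v w} = W.card := by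
      rw [Nat.card_eq_fintype_card, ← Set.toFinset_card]
      congr 1
      ext w
      simp [hW]
    rw [hcard] at hv
    have hWT : W ∈ T := by
      simp only [hT, Finset.mem_filter, Finset.mem_univ, true_and]
      exact ⟨⟨v, by simp [hW]⟩, hv⟩
    refine ⟨W, hWT, ?_⟩
    have h1 := aux_det s H hH _ hd v W (fun w => by simp [hW])
    have h2 := hlog0.le.trans (hLT W hWT).2
    exact Real.one_le_exp (mul_nonneg h2 (by simp only [ht]; linarith))

/-- Proposition 4.4: for fixed `ε ∈ (0,1/2)` and `np → ∞`, w.h.p. every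
spanning subgraph of `G_{n,p}` with all degrees `> (1-ε)np/2` has all components of order
at least `(1-2ε)n/2`. -/
theorem stmt9 (ε : ℝ) (hε : ε ∈ Set.Ioo (0 : ℝ) (1 / 2))
    (p : ℕ → ℝ) (hp : ∀ n, p n ∈ Set.Icc (0 : ℝ) 1)
    (hnp : Filter.Tendsto (fun n : ℕ => (n : ℝ) * p n) Filter.atTop Filter.atTop) :
    Filter.Tendsto (fun n => erProb n (p n)
      {G | ∀ H' : SimpleGraph (Fin n), H' ≤ G →
        (∀ v, (1 - ε) * (n : ℝ) * p n / 2 < (Nat.card ↥(H'.neighborSet v) : ℝ)) →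
        ∀ v : Fin n, (1 - 2 * ε) * (n : ℝ) / 2 ≤ (Nat.card ↥{w | H'.Reachable v w} : ℝ)})
      Filter.atTop (nhds 1) := by
  have hε' := hε
  obtain ⟨he0, he1⟩ := hε'
  obtain ⟨c, hc0, hc⟩ := aux_h (Real.log ((1 - ε) / (1 - 2 * ε)))
    (Real.log_pos (by rw [lt_div_iff₀ (by linarith)]; linarith))
  have hpos : 0 < (1 - ε) * c / 4 := by
    have : 0 < 1 - ε := by linarith
    positivity
  have hA : Filter.Tendsto (fun n : ℕ => (1 - ε) * c / 4 * ((n : ℝ) * p n) - 3)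
      Filter.atTop Filter.atTop :=
    Filter.tendsto_atTop_add_const_right _ (-3) (hnp.const_mul_atTop hpos)
  have hlow : Filter.Tendsto
      (fun n : ℕ => 1 - 2 * Real.exp (-((1 - ε) * c / 4 * ((n : ℝ) * p n) - 3)))
      Filter.atTop (nhds 1) := by
    have h := ((Real.tendsto_exp_neg_atTop_nhds_zero.comp hA).const_mul 2).const_sub 1
    simpa using h
  refine tendsto_of_tendsto_of_tendsto_of_le_of_le' hlow tendsto_const_nhds ?_ ?_
  · filter_upwards [hA.eventually_ge_atTop (Real.log 2), Filter.eventually_gt_atTop 0]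
      with n h1 h2
    exact aux_main ε hε c hc0 hc n h2 (p n) (hp n) h1
  · exact Filter.Eventually.of_forall fun n => erProb_le_one n (p n) (hp n) _

end RG
end
end

section
/- Let H be a strictly 2-balanced graph with d₂(H) > 1. Then for every vertex x of H, taking F = H, W = {x} and Z = V(H) (so that [W,Z] has edge set E(H) and internal vertex set V(H) ∖ {x}), the pair [{x}, V(H)] is strictly balanced, and its density satisfies d({x}, V(H)) = e_H/(v_H − 1) < d₂(H). -/
open Finset SimpleGraph Filter Topology

noncomputable section
open scoped Classical

namespace RG

variable {α β V : Type*}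

/-- The edges of `[{x}, Y]` are those of the induced subgraph on `Y`. -/
theorem eWZ_singleton {α : Type*} (H : SimpleGraph α) (x : α) (Y : Set α) :
    eWZ H ({x} : Set α) Y = Nat.card ↥(((⊤ : H.Subgraph).induce Y).edgeSet) := by
  unfold eWZ
  refine Nat.card_congr (Equiv.subtypeEquivRight ?_)
  intro q
  induction q using Sym2.ind with
  | _ a b =>
    simp only [SimpleGraph.mem_edgeSet, Sym2.mem_iff, forall_eq_or_imp, forall_eq,
      Set.mem_singleton_iff, SimpleGraph.Subgraph.mem_edgeSet,
      SimpleGraph.Subgraph.induce_adj, SimpleGraph.Subgraph.top_adj]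
    constructor
    · rintro ⟨h1, ⟨h2, h3⟩, -⟩
      exact ⟨h2, h3, h1⟩
    · rintro ⟨h2, h3, h1⟩
      exact ⟨h1, ⟨h2, h3⟩, fun h => h1.ne (h.1.trans h.2.symm)⟩

theorem eWZ_univ {α : Type*} (H : SimpleGraph α) (x : α) :
    eWZ H ({x} : Set α) Set.univ = eCount H := by
  rw [eWZ_singleton]
  unfold eCount
  refine Nat.card_congr (Equiv.subtypeEquivRight ?_)
  intro q
  induction q using Sym2.ind with
  | _ a b => simp

theorem vWZ_singleton {α : Type*} [Fintype α] (x : α) (Y : Set α) (hx : x ∈ Y) :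
    vWZ ({x} : Set α) Y + 1 = Nat.card ↥Y := by
  unfold vWZ
  rw [Nat.card_coe_set_eq, Nat.card_coe_set_eq]
  exact Set.ncard_sdiff_singleton_add_one hx

theorem eWZ_le_one {α : Type*} (H : SimpleGraph α) (x : α) (Y : Set α) (hx : x ∈ Y)
    (hY : Nat.card ↥Y = 2) : eWZ H ({x} : Set α) Y ≤ 1 := by
  rw [Nat.card_coe_set_eq, Set.ncard_eq_two] at hY
  obtain ⟨a, b, hab, rfl⟩ := hY
  rw [eWZ_singleton, Nat.card_coe_set_eq]
  refine (Set.ncard_le_ncard (t := {s(a, b)}) ?_ (Set.finite_singleton _)).trans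
    (Set.ncard_singleton _).le
  intro q
  induction q using Sym2.ind with
  | _ c d =>
    simp only [SimpleGraph.Subgraph.mem_edgeSet,
      SimpleGraph.Subgraph.induce_adj, SimpleGraph.Subgraph.top_adj, Set.mem_singleton_iff,
      Set.mem_insert_iff]
    rintro ⟨rfl | rfl, rfl | rfl, h⟩
    · exact (h.ne rfl).elim
    · rfl
    · exact Sym2.eq_swap
    · exact (h.ne rfl).elim

/-- Proposition 4.1: for strictly 2-balanced `H` with `d₂(H) > 1` and
any vertex `x`, `[{x}, V(H)]` is strictly balanced with density `e_H/(v_H-1) < d₂(H)`. -/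
theorem stmt11 {α : Type*} [Fintype α] (H : SimpleGraph α) (hH : Strictly2Balanced H)
    (hd : 1 < d2 H) (x : α) :
    StrictlyBalancedWZ H ({x} : Set α) Set.univ ∧
    dWZ H ({x} : Set α) Set.univ = (eCount H : ℝ) / ((Nat.card α : ℝ) - 1) ∧
    dWZ H ({x} : Set α) Set.univ < d2 H := by
  obtain ⟨hv, hK⟩ := hH
  have hvR : (3 : ℝ) ≤ (Nat.card α : ℝ) := by exact_mod_cast hv
  have hV : (vWZ ({x} : Set α) Set.univ : ℝ) = (Nat.card α : ℝ) - 1 := by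
    have h := vWZ_singleton x Set.univ (Set.mem_univ x)
    rw [Nat.card_coe_set_eq, Set.ncard_univ] at h
    rw [← h]; push_cast; ring
  have hD : dWZ H ({x} : Set α) Set.univ = (eCount H : ℝ) / ((Nat.card α : ℝ) - 1) := by
    unfold dWZ
    rw [hV, eWZ_univ]
  have hE : (eCount H : ℝ) = d2 H * ((Nat.card α : ℝ) - 2) + 1 := by
    have h2 : (Nat.card α : ℝ) - 2 ≠ 0 := by linarith
    unfold d2 density2
    rw [if_pos hv, div_mul_cancel₀ _ h2]; ring
  generalize hdd : d2 H = d at *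
  refine ⟨?_, hD, ?_⟩
  · intro Y hWY hYZ
    have hxY : x ∈ Y := hWY.1 rfl
    have hYv := vWZ_singleton x Y hxY
    have hYlt : Nat.card ↥Y < Nat.card α := by
      rw [Nat.card_coe_set_eq, ← Set.ncard_univ]
      exact Set.ncard_lt_ncard hYZ
    have hY2 : 2 ≤ Nat.card ↥Y := by
      have h := Set.ncard_lt_ncard hWY
      rw [Set.ncard_singleton] at h
      rw [Nat.card_coe_set_eq]; exact h
    have hEY : (eWZ H ({x} : Set α) Y : ℝ) ≤ d * ((Nat.card ↥Y : ℝ) - 2) + 1 := by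
      rcases hY2.eq_or_lt with h | h
      · have h1 := eWZ_le_one H x Y hxY h.symm
        have h1' : (eWZ H ({x} : Set α) Y : ℝ) ≤ 1 := by exact_mod_cast h1
        rw [← h]; push_cast; linarith
      · have hne : (⊤ : H.Subgraph).induce Y ≠ ⊤ := by
          intro he
          have := congrArg SimpleGraph.Subgraph.verts he
          simp only [SimpleGraph.Subgraph.induce_verts, SimpleGraph.Subgraph.verts_top] at this
          exact hYZ.ne this
        have h3 := hK _ hne
        unfold subDensity2 density2 at h3
        rw [← eWZ_singleton H x Y, SimpleGraph.Subgraph.induce_verts, if_pos (show 3 ≤ Nat.card ↥Y from h)] at h3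
        have h4 : (3 : ℝ) ≤ (Nat.card ↥Y : ℝ) := by exact_mod_cast (show 3 ≤ Nat.card ↥Y from h)
        rw [div_lt_iff₀ (by linarith)] at h3
        linarith
    rw [hD, hE]
    unfold dWZ
    have hYv' : (vWZ ({x} : Set α) Y : ℝ) = (Nat.card ↥Y : ℝ) - 1 := by
      rw [← hYv]; push_cast; ring
    rw [hYv']
    have hY2' : (2 : ℝ) ≤ (Nat.card ↥Y : ℝ) := by exact_mod_cast hY2
    have hYlt' : (Nat.card ↥Y : ℝ) < (Nat.card α : ℝ) := by exact_mod_cast hYlt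
    generalize (Nat.card ↥Y : ℝ) = y at *
    generalize (Nat.card α : ℝ) = v at *
    rw [div_lt_div_iff₀ (by linarith) (by linarith)]
    have h5 := mul_le_mul_of_nonneg_right hEY (by linarith : 0 ≤ v - 1)
    nlinarith [mul_pos (sub_pos.2 hd) (sub_pos.2 hYlt')]
  · rw [hD, hE, div_lt_iff₀ (by linarith)]
    linarith

end RG
end
end

section
/- Let F be a graph and W ⊊ Z ⊆ V(F) with e(W,Z) ≥ 1 and [W,Z] strictly balanced. Then there exists ϖ > 0 (depending on [W,Z]) such that for every D > 0 there is a C > 0 with the following property: for all sufficiently large n, every p ∈ (0,1] with p ≤ n^{−1/d(W,Z)+ϖ}, and every tuple X of |W| distinct vertices of [n], P(τ_{[W,Z]}(G_{n,p}, X) − σ_{[W,Z]}(G_{n,p}, X) > C) < n^{−D}. -/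
open Finset SimpleGraph Filter Topology

noncomputable section
open scoped Classical

namespace RG

variable {α β V : Type*}

/-- The edges of `[W,Z]` as a set. -/
def edg (F : SimpleGraph β) (W Z : Set β) : Set (Sym2 β) :=
  {q | q ∈ F.edgeSet ∧ (∀ a ∈ q, a ∈ Z) ∧ ¬(∀ a ∈ q, a ∈ W)}

lemma eWZ_eq (F : SimpleGraph β) (W Z : Set β) : eWZ F W Z = (edg F W Z).ncard := rfl

lemma vWZ_eq (W Z : Set β) : vWZ W Z = (Z \ W).ncard := rfl

/-- `g` realises the copy with internal vertices `A` and edges `B`. -/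
def Real' (F : SimpleGraph β) (W Z : Set β) (G : SimpleGraph V) (x : ↥W → V)
    (A : Set V) (B : Set (Sym2 V)) (g : β → V) : Prop :=
  Set.InjOn g Z ∧ (∀ (w : β) (hw : w ∈ W), g w = x ⟨w, hw⟩) ∧ A = g '' (Z \ W) ∧
    B = Sym2.map g '' edg F W Z ∧ B ⊆ G.edgeSet

lemma exists_real (F : SimpleGraph β) (W Z : Set β) (hWZ : W ⊂ Z) (G : SimpleGraph V) (x : ↥W → V)
    (d : Set V × Set (Sym2 V)) (hd : d ∈ copySet F W Z G x) :
    ∃ g, Real' F W Z G x d.1 d.2 g := by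
  obtain ⟨ψ, ⟨hinj, hx, hG⟩, rfl⟩ := hd
  obtain ⟨z0, hz0, -⟩ := Set.exists_of_ssubset hWZ
  set g : β → V := fun b => if h : b ∈ Z then ψ ⟨b, h⟩ else ψ ⟨z0, hz0⟩ with hg
  have gz : ∀ (b : β) (h : b ∈ Z), g b = ψ ⟨b, h⟩ := fun b h => by simp [hg, h]
  have h2 : (extData F W Z ψ).2 = Sym2.map g '' edg F W Z := by
    ext q
    constructor
    · rintro ⟨a, b, ⟨hab, hn⟩, rfl⟩
      refine ⟨s((a : β), (b : β)), ⟨hab, ?_, ?_⟩, ?_⟩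
      · intro c hc
        rcases Sym2.mem_iff.1 hc with rfl | rfl
        · exact a.2
        · exact b.2
      · intro h
        exact hn ⟨h _ (Sym2.mem_mk_left _ _), h _ (Sym2.mem_mk_right _ _)⟩
      · simp [gz _ a.2, gz _ b.2]
    · rintro ⟨q', ⟨h1, h2, h3⟩, rfl⟩
      induction q' with
      | h a b =>
        have ha := h2 a (Sym2.mem_mk_left _ _)
        have hb := h2 b (Sym2.mem_mk_right _ _)
        refine ⟨⟨a, ha⟩, ⟨b, hb⟩, ⟨h1, ?_⟩, ?_⟩
        · rintro ⟨h, h'⟩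
          apply h3
          intro c hc
          rcases Sym2.mem_iff.1 hc with rfl | rfl
          · exact h
          · exact h'
        · simp [gz _ ha, gz _ hb]
  refine ⟨g, ?_, ?_, ?_, h2, ?_⟩
  · intro a ha b hb hab
    rw [gz a ha, gz b hb] at hab
    exact congrArg Subtype.val (hinj hab)
  · intro w hw
    rw [gz w (hWZ.1 hw)]
    exact hx _ hw
  · ext y
    constructor
    · rintro ⟨z, hz, rfl⟩
      exact ⟨z, ⟨z.2, hz⟩, gz _ z.2⟩
    · rintro ⟨z, ⟨hz, hz'⟩, rfl⟩
      exact ⟨⟨z, hz⟩, hz', (gz _ hz).symm⟩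
  · rintro q ⟨a, b, hab, rfl⟩
    exact hG a b hab

lemma map_injOn {g : β → V} {Z : Set β} (hg : Set.InjOn g Z) :
    Set.InjOn (Sym2.map g) {q : Sym2 β | ∀ a ∈ q, a ∈ Z} := by
  intro q hq r hr h
  induction q with
  | h a b =>
    induction r with
    | h c d =>
      have ha := hq a (Sym2.mem_mk_left _ _)
      have hb := hq b (Sym2.mem_mk_right _ _)
      have hc := hr c (Sym2.mem_mk_left _ _)
      have hd := hr d (Sym2.mem_mk_right _ _)
      simp only [Sym2.map_mk, Sym2.eq_iff] at h
      rw [Sym2.eq_iff]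
      rcases h with ⟨h1, h2⟩ | ⟨h1, h2⟩
      · exact Or.inl ⟨hg ha hc h1, hg hb hd h2⟩
      · exact Or.inr ⟨hg ha hd h1, hg hb hc h2⟩

lemma ncard_map_edg {F : SimpleGraph β} {g : β → V} {Z : Set β} (hg : Set.InjOn g Z) (Y : Set β) :
    (Sym2.map g '' edg F Y Z).ncard = eWZ F Y Z := by
  rw [eWZ_eq]
  exact Set.ncard_image_of_injOn ((map_injOn hg).mono fun q hq => hq.2.1)

lemma step [Finite V] [Finite β] {F : SimpleGraph β} {W Z : Set β} (hWZ : W ⊂ Z)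
    {G : SimpleGraph V} {x : ↥W → V}
    {A : Set V} {B : Set (Sym2 V)} {g : β → V} (hr : Real' F W Z G x A B g)
    (S : Set V) (E : Set (Sym2 V)) (hE : ∀ q ∈ E, ∀ a ∈ q, a ∈ S ∨ a ∈ Set.range x) :
    (S ∪ A).ncard = S.ncard + vWZ (W ∪ (Z ∩ g ⁻¹' S)) Z ∧
    E.ncard + eWZ F (W ∪ (Z ∩ g ⁻¹' S)) Z ≤ (E ∪ B).ncard := by
  obtain ⟨hinj, hx, rfl, rfl, hG⟩ := hr
  set Y := W ∪ (Z ∩ g ⁻¹' S) with hY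
  constructor
  · have h1 : S ∪ g '' (Z \ W) = S ∪ g '' (Z \ Y) := by
      ext y
      constructor
      · rintro (h | ⟨z, ⟨hz, hw⟩, rfl⟩)
        · exact Or.inl h
        · by_cases hs : g z ∈ S
          · exact Or.inl hs
          · refine Or.inr ⟨z, ⟨hz, ?_⟩, rfl⟩
            rintro (h | h)
            · exact hw h
            · exact hs h.2
      · rintro (h | ⟨z, ⟨hz, hw⟩, rfl⟩)
        · exact Or.inl h
        · exact Or.inr ⟨z, ⟨hz, fun h => hw (Or.inl h)⟩, rfl⟩
    rw [h1, Set.ncard_union_eq, vWZ_eq, Set.ncard_image_of_injOn (hinj.mono Set.diff_subset)]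
    rw [Set.disjoint_left]
    rintro y hy ⟨z, ⟨hz, hw⟩, rfl⟩
    exact hw (Or.inr ⟨hz, hy⟩)
  · rw [← ncard_map_edg (F := F) hinj Y, ← Set.ncard_union_eq]
    · refine Set.ncard_le_ncard (Set.union_subset_union_right _ (Set.image_mono ?_))
      rintro q ⟨h1, h2, h3⟩
      exact ⟨h1, h2, fun h => h3 fun a ha => Or.inl (h a ha)⟩
    · rw [Set.disjoint_left]
      rintro q hq ⟨q', ⟨h1, h2, h3⟩, rfl⟩
      push Not at h3
      obtain ⟨a, ha, haY⟩ := h3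
      rcases hE _ hq (g a) (Sym2.mem_map.2 ⟨a, ha, rfl⟩) with h | ⟨w, hw⟩
      · exact haY (Or.inr ⟨h2 a ha, h⟩)
      · apply haY
        left
        have := hx w w.2
        have h5 : g w = g a := by rw [this, ← hw]
        rw [← hinj (hWZ.1 w.2) (h2 a ha) h5]
        exact w.2

lemma v_add [Finite β] {W Y Z : Set β} (h1 : W ⊆ Y) (h2 : Y ⊆ Z) :
    vWZ W Z = vWZ W Y + vWZ Y Z := by
  rw [vWZ_eq, vWZ_eq, vWZ_eq, ← Set.ncard_union_eq]
  · congr 1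
    ext a
    have := @h1 a
    have := @h2 a
    simp only [Set.mem_diff, Set.mem_union]
    tauto
  · rw [Set.disjoint_left]
    rintro a ⟨h, _⟩ ⟨_, h'⟩
    exact h' h

lemma e_add [Finite β] (F : SimpleGraph β) {W Y Z : Set β} (h1 : W ⊆ Y) (h2 : Y ⊆ Z) :
    eWZ F W Z = eWZ F W Y + eWZ F Y Z := by
  rw [eWZ_eq, eWZ_eq, eWZ_eq, ← Set.ncard_union_eq]
  · congr 1
    ext q
    have : (∀ a ∈ q, a ∈ W) → (∀ a ∈ q, a ∈ Y) := fun h a ha => h1 (h a ha)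
    have : (∀ a ∈ q, a ∈ Y) → (∀ a ∈ q, a ∈ Z) := fun h a ha => h2 (h a ha)
    simp only [edg, Set.mem_setOf_eq, Set.mem_union]
    tauto
  · rw [Set.disjoint_left]
    rintro a ⟨_, h, _⟩ ⟨_, _, h'⟩
    exact h' h

/-- The numerical gap. -/
lemma exists_gap [Finite β] (F : SimpleGraph β) (W Z : Set β) (hWZ : W ⊂ Z)
    (he : 1 ≤ eWZ F W Z) (hbal : StrictlyBalancedWZ F W Z) :
    ∃ δ : ℝ, 0 < δ ∧ δ ≤ 1 / dWZ F W Z ∧ ∀ Y, W ⊂ Y → Y ⊂ Z →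
      δ ≤ (eWZ F Y Z : ℝ) * (1 / dWZ F W Z) - vWZ Y Z := by
  have hv : ∀ {Y : Set β}, W ⊂ Y → 0 < vWZ W Y := by
    intro Y h
    rw [vWZ_eq, Set.ncard_pos]
    obtain ⟨z, hz, hw⟩ := Set.exists_of_ssubset h
    exact ⟨z, hz, hw⟩
  have hd : 0 < dWZ F W Z := by
    unfold dWZ
    have := hv hWZ
    positivity
  have key : ∀ Y, W ⊂ Y → Y ⊂ Z → 0 < (eWZ F Y Z : ℝ) * (1 / dWZ F W Z) - vWZ Y Z := by
    intro Y h1 h2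
    have hb := hbal Y h1 h2
    have e1 : (eWZ F W Y : ℝ) < dWZ F W Z * vWZ W Y := by
      have : (0 : ℝ) < vWZ W Y := by exact_mod_cast hv h1
      unfold dWZ at hb ⊢
      rwa [div_lt_iff₀ this] at hb
    have e2 : (eWZ F W Z : ℝ) = dWZ F W Z * vWZ W Z := by
      have : (0 : ℝ) < vWZ W Z := by exact_mod_cast hv hWZ
      unfold dWZ
      field_simp
    have e3 : (eWZ F W Z : ℝ) = eWZ F W Y + eWZ F Y Z := by exact_mod_cast e_add F h1.1 h2.1
    have e4 : (vWZ W Z : ℝ) = vWZ W Y + vWZ Y Z := by exact_mod_cast v_add h1.1 h2.1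
    rw [sub_pos, mul_one_div, lt_div_iff₀ hd]
    rw [e4] at e2
    linarith
  let T : Set ℝ := insert (1 / dWZ F W Z)
    ((fun Y => (eWZ F Y Z : ℝ) * (1 / dWZ F W Z) - vWZ Y Z) '' {Y | W ⊂ Y ∧ Y ⊂ Z})
  have hT : T.Finite := (Set.toFinite _).insert _
  obtain ⟨δ, hδ, hmin⟩ := Set.exists_min_image T id hT ⟨_, Set.mem_insert _ _⟩
  refine ⟨δ, ?_, hmin _ (Set.mem_insert _ _), fun Y h1 h2 =>
    hmin _ (Set.mem_insert_of_mem _ ⟨Y, ⟨h1, h2⟩, rfl⟩)⟩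
  rcases hδ with rfl | ⟨Y, ⟨h1, h2⟩, rfl⟩
  · positivity
  · exact key Y h1 h2

/-- Invariant of the growing structure. -/
def Inv (G : SimpleGraph V) {W : Set β} (x : ↥W → V) (S : Set V) (E : Set (Sym2 V)) : Prop :=
  (∀ q ∈ E, ∀ a ∈ q, a ∈ S ∨ a ∈ Set.range x) ∧ E ⊆ G.edgeSet

lemma Inv.union {F : SimpleGraph β} {W Z : Set β}
    {G : SimpleGraph V} {x : ↥W → V}
    {A : Set V} {B : Set (Sym2 V)} {g : β → V} (hr : Real' F W Z G x A B g)
    {S : Set V} {E : Set (Sym2 V)} (h : Inv G x S E) : Inv G x (S ∪ A) (E ∪ B) := by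
  obtain ⟨hinj, hx, rfl, rfl, hG⟩ := hr
  refine ⟨?_, Set.union_subset h.2 hG⟩
  rintro q (hq | ⟨q', ⟨h1, h2, h3⟩, rfl⟩) a ha
  · exact (h.1 q hq a ha).imp Or.inl id
  · obtain ⟨b, hb, rfl⟩ := Sym2.mem_map.1 ha
    by_cases hw : b ∈ W
    · exact Or.inr ⟨⟨b, hw⟩, (hx b hw).symm⟩
    · exact Or.inl (Or.inr ⟨b, ⟨h2 b hb, hw⟩, rfl⟩)

lemma step_overlap [Finite V] [Finite β] {F : SimpleGraph β} {W Z : Set β} (hWZ : W ⊂ Z)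
    {G : SimpleGraph V} {x : ↥W → V}
    {A : Set V} {B : Set (Sym2 V)} {g : β → V} (hr : Real' F W Z G x A B g)
    {S : Set V} {E : Set (Sym2 V)} (hI : Inv G x S E) {θ ε : ℝ} (hεθ : ε ≤ θ)
    (hgap : ∀ Y, W ⊂ Y → Y ⊂ Z → ε ≤ (eWZ F Y Z : ℝ) * θ - vWZ Y Z) (hε : 0 < ε)
    (hmeet : (A ∩ S).Nonempty) (hnot : ¬ (A ⊆ S ∧ B ⊆ E)) :
    ((S ∪ A).ncard : ℝ) - θ * (E ∪ B).ncard ≤ S.ncard - θ * E.ncard - ε := by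
  obtain ⟨h1, h2⟩ := step hWZ hr S E hI.1
  obtain ⟨hinj, hx, hA, hB, hG⟩ := hr
  have hθ : 0 < θ := hε.trans_le hεθ
  set Y := W ∪ (Z ∩ g ⁻¹' S) with hY
  have hWY : W ⊂ Y := by
    obtain ⟨y, hy, hyS⟩ := hmeet
    rw [hA] at hy
    obtain ⟨z, ⟨hz, hw⟩, rfl⟩ := hy
    exact Set.ssubset_iff_of_subset Set.subset_union_left |>.2 ⟨z, Or.inr ⟨hz, hyS⟩, hw⟩
  have hYZ : Y ⊆ Z := Set.union_subset hWZ.1 Set.inter_subset_left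
  by_cases hEq : Y = Z
  · have hAS : A ⊆ S := by
      rw [hA]
      rintro _ ⟨z, ⟨hz, hw⟩, rfl⟩
      rw [← hEq] at hz
      rcases hz with h | h
      · exact absurd h hw
      · exact h.2
    have hBE : ¬ B ⊆ E := fun h => hnot ⟨hAS, h⟩
    rw [Set.union_eq_self_of_subset_right hAS]
    have : E.ncard < (E ∪ B).ncard := by
      refine Set.ncard_lt_ncard ?_
      refine Set.ssubset_iff_subset_ne.2 ⟨Set.subset_union_left, fun h => hBE ?_⟩
      rw [h]
      exact Set.subset_union_right
    have h3 : (E.ncard : ℝ) + 1 ≤ (E ∪ B).ncard := by exact_mod_cast this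
    nlinarith
  · have h3 := hgap Y hWY (Set.ssubset_iff_subset_ne.2 ⟨hYZ, hEq⟩)
    have h4 : ((E.ncard : ℝ)) + eWZ F Y Z ≤ (E ∪ B).ncard := by exact_mod_cast h2
    have h5 : ((S ∪ A).ncard : ℝ) = S.ncard + vWZ Y Z := by exact_mod_cast h1
    nlinarith

lemma ncard_A_le [Finite β] {F : SimpleGraph β} {W Z : Set β}
    {G : SimpleGraph V} {x : ↥W → V}
    {A : Set V} {B : Set (Sym2 V)} {g : β → V} (hr : Real' F W Z G x A B g) :
    A.ncard = vWZ W Z := by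
  obtain ⟨hinj, hx, rfl, hB, hG⟩ := hr
  rw [vWZ_eq, Set.ncard_image_of_injOn (hinj.mono Set.diff_subset)]

/-- One extension step. -/
lemma grow [Finite V] [Finite β] {F : SimpleGraph β} {W Z : Set β} (hWZ : W ⊂ Z)
    {G : SimpleGraph V} {x : ↥W → V}
    {S : Set V} {E : Set (Sym2 V)} (hI : Inv G x S E) {θ ε η : ℝ} (hεθ : ε ≤ θ)
    (hgap : ∀ Y, W ⊂ Y → Y ⊂ Z → ε ≤ (eWZ F Y Z : ℝ) * θ - vWZ Y Z) (hε : 0 < ε)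
    (hη : (vWZ W Z : ℝ) - θ * eWZ F W Z ≤ η) (hη0 : 0 ≤ η) (C : ℕ)
    (hC : {d : Set V × Set (Sym2 V) | d ∈ copySet F W Z G x ∧ d.1 ⊆ S ∧ d.2 ⊆ E}.ncard ≤ C)
    (hbig : sigmaExt F W Z G x + C < tauExt F W Z G x) :
    ∃ S' E', Inv G x S' E' ∧ S'.ncard ≤ S.ncard + 2 * vWZ W Z ∧
      (S'.ncard : ℝ) - θ * E'.ncard ≤ S.ncard - θ * E.ncard - (ε - η) := by
  by_cases ha : ∃ d ∈ copySet F W Z G x, (d.1 ∩ S).Nonempty ∧ ¬ (d.1 ⊆ S ∧ d.2 ⊆ E)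
  · obtain ⟨d, hd, hm, hn⟩ := ha
    obtain ⟨g, hr⟩ := exists_real F W Z hWZ G x d hd
    refine ⟨S ∪ d.1, E ∪ d.2, hI.union hr, ?_, ?_⟩
    · have := Set.ncard_union_le S d.1
      rw [ncard_A_le hr] at this
      omega
    · have := step_overlap hWZ hr hI hεθ hgap hε hm hn
      linarith
  push Not at ha
  by_cases hb : ∃ d ∈ copySet F W Z G x, ∃ d' ∈ copySet F W Z G x, d ≠ d' ∧ ¬ (d.1 ∩ S).Nonempty ∧
      ¬ (d'.1 ∩ S).Nonempty ∧ (d.1 ∩ d'.1).Nonempty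
  · obtain ⟨d, hd, d', hd', hne, hS, hS', hm⟩ := hb
    obtain ⟨g, hr⟩ := exists_real F W Z hWZ G x d hd
    obtain ⟨g', hr'⟩ := exists_real F W Z hWZ G x d' hd'
    have hI1 := hI.union hr
    refine ⟨(S ∪ d.1) ∪ d'.1, (E ∪ d.2) ∪ d'.2, hI1.union hr', ?_, ?_⟩
    · have := Set.ncard_union_le S d.1
      have h2 := Set.ncard_union_le (S ∪ d.1) d'.1
      rw [ncard_A_le hr] at this
      rw [ncard_A_le hr'] at h2
      omega
    · have hs2 := step_overlap hWZ hr' hI1 hεθ hgap hε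
        (by
          obtain ⟨y, h1, h2⟩ := hm
          exact ⟨y, h2, Or.inr h1⟩)
        (by
          rintro ⟨h1, h2⟩
          apply hne
          have hdisj : ∀ y ∈ d'.1, y ∉ S := fun y hy hyS => hS' ⟨y, hy, hyS⟩
          have e1 : d'.1 = d.1 := by
            refine Set.eq_of_subset_of_ncard_le (fun y hy => ?_)
              (by rw [ncard_A_le hr, ncard_A_le hr'])
            exact (h1 hy).resolve_left (hdisj y hy)
          have e2 : d'.2 = d.2 := by
            refine Set.eq_of_subset_of_ncard_le (fun q hq => ?_) ?_
            · refine (h2 hq).resolve_left fun hqE => ?_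
              obtain ⟨hinj, hx, hA, hB, hG⟩ := hr'
              rw [hB] at hq
              obtain ⟨q', ⟨k1, k2, k3⟩, rfl⟩ := hq
              push Not at k3
              obtain ⟨a, ha, haW⟩ := k3
              have hga : g' a ∈ d'.1 := by
                rw [hA]
                exact ⟨a, ⟨k2 a ha, haW⟩, rfl⟩
              rcases hI.1 _ hqE (g' a) (Sym2.mem_map.2 ⟨a, ha, rfl⟩) with h | ⟨w, hw⟩
              · exact hdisj _ hga h
              · have h5 : g' w = g' a := by rw [hx w w.2, ← hw]
                rw [← hinj (hWZ.1 w.2) (k2 a ha) h5] at haW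
                exact haW w.2
            · rw [hr.2.2.2.1, hr'.2.2.2.1, ncard_map_edg hr.1, ncard_map_edg hr'.1]
          exact Prod.ext e1.symm e2.symm)
      obtain ⟨k1, k2⟩ := step hWZ hr S E hI.1
      have hY : W ∪ (Z ∩ g ⁻¹' S) = W := by
        refine Set.union_eq_self_of_subset_right ?_
        rintro z ⟨hz, hzS⟩
        by_contra hw
        apply hS
        rw [hr.2.2.1]
        exact ⟨g z, ⟨z, ⟨hz, hw⟩, rfl⟩, hzS⟩
      rw [hY] at k1 k2
      have k3 : ((S ∪ d.1).ncard : ℝ) = S.ncard + vWZ W Z := by exact_mod_cast k1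
      have k4 : (E.ncard : ℝ) + eWZ F W Z ≤ (E ∪ d.2).ncard := by exact_mod_cast k2
      have hθ : 0 < θ := hε.trans_le hεθ
      nlinarith
  push Not at hb
  exfalso
  set P := copySet F W Z G x with hP
  set P1 : Set (Set V × Set (Sym2 V)) := {d | d ∈ P ∧ d.1 ⊆ S ∧ d.2 ⊆ E} with hP1
  have hfin : (P \ P1).Finite := Set.toFinite _
  have hσ : (P \ P1).ncard ≤ sigmaExt F W Z G x := by
    refine le_csSup ?_ ⟨hfin.toFinset, ?_, ?_, ?_⟩
    · refine ⟨Nat.card (Set V × Set (Sym2 V)), ?_⟩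
      rintro m ⟨T, -, -, rfl⟩
      rw [← Set.ncard_coe_finset]
      exact Set.ncard_le_card _
    · rw [Set.Finite.coe_toFinset]
      exact Set.diff_subset
    · intro d hd d' hd' hne
      rw [Set.Finite.mem_toFinset] at hd hd'
      have no : ∀ d ∈ P \ P1, d.1 ∩ S = ∅ := by
        intro d hd
        by_contra hcon
        have := ha d hd.1 (Set.nonempty_iff_ne_empty.2 hcon)
        exact hd.2 ⟨hd.1, this⟩
      by_contra hcon
      have h1 := hb d hd.1 d' hd'.1 hne (no d hd) (no d' hd')
      exact hcon h1
    · rw [Set.ncard_eq_toFinset_card _ hfin]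
  have hle : P.ncard ≤ (P \ P1).ncard + P1.ncard := by
    rw [Set.ncard_diff_add_ncard_of_subset]
    intro d hd
    exact hd.1
  have ht : tauExt F W Z G x = P.ncard := rfl
  omega

lemma contained_le [Finite V] [Finite β] {F : SimpleGraph β} {W Z : Set β}
    {G : SimpleGraph V} {x : ↥W → V} {S : Set V} {E : Set (Sym2 V)} (hI : Inv G x S E) (m : ℕ)
    (hm : S.ncard ≤ m) :
    {d : Set V × Set (Sym2 V) | d ∈ copySet F W Z G x ∧ d.1 ⊆ S ∧ d.2 ⊆ E}.ncard
      ≤ 2 ^ m * 2 ^ ((m + W.ncard + 1) ^ 2) := by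
  haveI := Fintype.ofFinite V
  have hEc : E.ncard ≤ (m + W.ncard + 1) ^ 2 := by
    have h1 : E ⊆ ((S ∪ Set.range x).toFinset.sym2 : Finset (Sym2 V)) := by
      intro q hq
      simp only [Finset.mem_coe, Finset.mem_sym2_iff, Set.mem_toFinset]
      exact fun a ha => hI.1 q hq a ha
    have h2 := Set.ncard_le_ncard h1
    rw [Set.ncard_coe_finset, Finset.card_sym2, ← Set.ncard_eq_toFinset_card'] at h2
    have h3 : (S ∪ Set.range x).ncard ≤ m + W.ncard := by
      refine (Set.ncard_union_le _ _).trans (add_le_add hm ?_)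
      rw [← Set.image_univ]
      refine (Set.ncard_image_le).trans ?_
      rw [Set.ncard_univ]
      rfl
    refine h2.trans ((Nat.choose_le_pow _ _).trans (Nat.pow_le_pow_left (by omega) _))
  have hsub : {d : Set V × Set (Sym2 V) | d ∈ copySet F W Z G x ∧ d.1 ⊆ S ∧ d.2 ⊆ E}
      ⊆ (𝒫 S) ×ˢ (𝒫 E) := fun d hd => ⟨hd.2.1, hd.2.2⟩
  refine (Set.ncard_le_ncard hsub).trans ?_
  rw [Set.ncard_prod, Set.ncard_powerset, Set.ncard_powerset]
  exact Nat.mul_le_mul (Nat.pow_le_pow_right (by norm_num) hm)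
    (Nat.pow_le_pow_right (by norm_num) hEc)

lemma determ [Finite V] [Finite β] {F : SimpleGraph β} {W Z : Set β} (hWZ : W ⊂ Z)
    {G : SimpleGraph V} {x : ↥W → V} {θ ε η : ℝ} (hεθ : ε ≤ θ)
    (hgap : ∀ Y, W ⊂ Y → Y ⊂ Z → ε ≤ (eWZ F Y Z : ℝ) * θ - vWZ Y Z) (hε : 0 < ε)
    (hη : (vWZ W Z : ℝ) - θ * eWZ F W Z ≤ η) (hη0 : 0 ≤ η) (K : ℕ)
    (hbig : sigmaExt F W Z G x + 2 ^ (2 * vWZ W Z * K) *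
      2 ^ ((2 * vWZ W Z * K + W.ncard + 1) ^ 2) < tauExt F W Z G x) (k : ℕ) (hk : k ≤ K) :
    ∃ S E, Inv G x S E ∧ S.ncard ≤ 2 * vWZ W Z * k ∧
      (S.ncard : ℝ) - θ * E.ncard ≤ - (k * (ε - η)) := by
  induction k with
  | zero => exact ⟨∅, ∅, ⟨by simp, by simp⟩, by simp, by simp⟩
  | succ k ih =>
    obtain ⟨S, E, hI, h1, h2⟩ := ih (by omega)
    have h3 : S.ncard ≤ 2 * vWZ W Z * K := h1.trans (Nat.mul_le_mul_left _ (by omega))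
    obtain ⟨S', E', hI', h1', h2'⟩ := grow hWZ hI hεθ hgap hε hη hη0 _ (contained_le hI _ h3) hbig
    refine ⟨S', E', hI', ?_, ?_⟩
    · rw [Nat.mul_succ]
      omega
    · push_cast
      linarith

/-- Probability of containing a given edge set. -/
lemma sum_contain {ι : Type*} (M E : Finset ι) (hE : E ⊆ M) (p : ℝ) :
    ∑ s ∈ M.powerset, (if E ⊆ s then p ^ s.card * (1 - p) ^ (M.card - s.card) else 0)
      = p ^ E.card := by
  rw [← Finset.sum_filter]
  have h1 : ∑ t ∈ (M \ E).powerset, p ^ t.card * (1 - p) ^ ((M \ E).card - t.card) = 1 := by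
    rw [Finset.sum_pow_mul_eq_add_pow]
    simp
  refine Eq.trans ?_ (mul_one (p ^ E.card))
  refine Eq.trans ?_ (congrArg (fun y => p ^ E.card * y) h1)
  rw [Finset.mul_sum]
  refine Finset.sum_bij' (fun s _ => s \ E) (fun t _ => t ∪ E) ?_ ?_ ?_ ?_ ?_
  · intro s hs
    simp only [Finset.mem_filter, Finset.mem_powerset] at hs ⊢
    exact Finset.sdiff_subset_sdiff hs.1 le_rfl
  · intro t ht
    simp only [Finset.mem_filter, Finset.mem_powerset] at ht ⊢
    exact ⟨Finset.union_subset (ht.trans Finset.sdiff_subset) hE, Finset.subset_union_right⟩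
  · intro s hs
    simp only [Finset.mem_filter, Finset.mem_powerset] at hs
    exact Finset.sdiff_union_of_subset hs.2
  · intro t ht
    simp only [Finset.mem_powerset] at ht
    rw [Finset.union_sdiff_right]
    refine Finset.sdiff_eq_self_of_disjoint ?_
    exact Finset.disjoint_of_subset_left ht Finset.sdiff_disjoint
  · intro s hs
    simp only [Finset.mem_filter, Finset.mem_powerset] at hs
    have c1 := Finset.card_sdiff_of_subset hs.2
    have c2 := Finset.card_sdiff_of_subset hE
    have c3 := Finset.card_le_card hs.2
    have c4 := Finset.card_le_card hs.1
    rw [c1, c2, ← mul_assoc, ← pow_add]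
    have e1 : E.card + (s.card - E.card) = s.card := by omega
    have e2 : M.card - E.card - (s.card - E.card) = M.card - s.card := by omega
    rw [e1, e2]

lemma union_bound {n : ℕ} {p : ℝ} (hp0 : 0 ≤ p) (hp1 : p ≤ 1) {A : Set (SimpleGraph (Fin n))}
    {ι : Type*} (I : Finset ι) (E : ι → Finset (Sym2 (Fin n)))
    (h : ∀ G ∈ A, ∃ i ∈ I, (E i : Set (Sym2 (Fin n))) ⊆ G.edgeSet) :
    erProb n p A ≤ ∑ i ∈ I, p ^ (E i).card := by
  set M := (⊤ : SimpleGraph (Fin n)).edgeFinset with hM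
  have hq : 0 ≤ 1 - p := by linarith
  have h1 : erProb n p A ≤ ∑ s ∈ M.powerset, ∑ i ∈ I,
      (if E i ⊆ s then p ^ s.card * (1 - p) ^ (M.card - s.card) else 0) := by
    unfold erProb
    refine Finset.sum_le_sum fun s hs => ?_
    split_ifs with hA
    · obtain ⟨i, hi, hiE⟩ := h _ hA
      have hsub : E i ⊆ s := by
        intro q hq
        have := hiE hq
        rw [SimpleGraph.edgeSet_fromEdgeSet] at this
        exact this.1
      refine le_trans (le_of_eq ?_) (Finset.single_le_sum (fun j _ => ?_) hi)
      · rw [if_pos hsub]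
      · split_ifs <;> positivity
    · refine Finset.sum_nonneg fun j _ => ?_
      split_ifs <;> positivity
  refine h1.trans ?_
  rw [Finset.sum_comm]
  refine Finset.sum_le_sum fun i _ => ?_
  by_cases hE : E i ⊆ M
  · have := (sum_contain M (E i) hE p).le
    convert this
  · refine le_trans (le_of_eq ?_) (pow_nonneg hp0 _)
    refine Finset.sum_eq_zero fun s hs => ?_
    rw [if_neg]
    exact fun h' => hE (h'.trans (Finset.mem_powerset.1 hs))

lemma prob_part {n : ℕ} (hn : 1 ≤ n) {p θ L : ℝ} (hp0 : 0 < p) (hp1 : p ≤ 1)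
    (hp : p ≤ (n : ℝ) ^ (-θ)) [Finite β] {W : Set β} (x : ↥W → Fin n) (m : ℕ)
    {A : Set (SimpleGraph (Fin n))}
    (h : ∀ G ∈ A, ∃ S E, Inv G x S E ∧ S.ncard ≤ m ∧ (S.ncard : ℝ) - θ * E.ncard ≤ - L) :
    erProb n p A ≤ ((m + 1) * 2 ^ ((m + W.ncard + 1) ^ 2) : ℕ) * (n : ℝ) ^ (-L) := by
  have hn0 : (0 : ℝ) < n := by exact_mod_cast hn
  have hn1 : (1 : ℝ) ≤ n := by exact_mod_cast hn
  let I1 : Finset (Finset (Fin n)) := (Finset.range (m + 1)).biUnion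
    fun s => Finset.powersetCard s Finset.univ
  let R : Finset (Fin n) → Finset (Sym2 (Fin n)) := fun S => (S ∪ (Set.range x).toFinset).sym2
  let I : Finset ((_ : Finset (Fin n)) × Finset (Sym2 (Fin n))) := I1.sigma fun S =>
    (R S).powerset.filter fun E => (S.card : ℝ) - θ * E.card ≤ -L
  have hR : ∀ S : Finset (Fin n), S.card ≤ m → (R S).card ≤ (m + W.ncard + 1) ^ 2 := by
    intro S hS
    rw [Finset.card_sym2]
    have h3 : (S ∪ (Set.range x).toFinset).card ≤ m + W.ncard := by
      refine (Finset.card_union_le _ _).trans (add_le_add hS ?_)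
      rw [← Set.ncard_eq_toFinset_card', ← Set.image_univ]
      refine (Set.ncard_image_le).trans ?_
      rw [Set.ncard_univ]
      rfl
    exact (Nat.choose_le_pow _ _).trans (Nat.pow_le_pow_left (by omega) _)
  have h1 := union_bound hp0.le hp1 (A := A) I (fun i => i.2) (by
    intro G hG
    obtain ⟨S, E, hI, hS, hL⟩ := h G hG
    refine ⟨⟨S.toFinset, E.toFinset⟩, ?_, ?_⟩
    · simp only [I, I1, R, Finset.mem_sigma, Finset.mem_biUnion, Finset.mem_range,
        Finset.mem_powersetCard, Finset.mem_filter, Finset.mem_powerset]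
      refine ⟨⟨S.ncard, by omega, Finset.subset_univ _, (Set.ncard_eq_toFinset_card' S).symm⟩, ?_, ?_⟩
      · intro q hq
        simp only [Finset.mem_sym2_iff, Finset.mem_union, Set.mem_toFinset] at hq ⊢
        exact hI.1 q hq
      · rw [← Set.ncard_eq_toFinset_card', ← Set.ncard_eq_toFinset_card']
        exact hL
    · simpa using hI.2)
  refine h1.trans ?_
  rw [Finset.sum_sigma]
  have h2 : ∀ S ∈ I1, ∑ E ∈ (R S).powerset.filter (fun E => (S.card : ℝ) - θ * E.card ≤ -L),
      p ^ E.card ≤ (2 : ℝ) ^ ((m + W.ncard + 1) ^ 2) * ((n : ℝ) ^ (-L) * ((n : ℝ) ^ S.card)⁻¹) := by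
    intro S hS
    have hSm : S.card ≤ m := by
      simp only [I1, Finset.mem_biUnion, Finset.mem_range, Finset.mem_powersetCard] at hS
      obtain ⟨s, hs, -, rfl⟩ := hS
      omega
    have h3 : ∀ E ∈ (R S).powerset.filter (fun E => (S.card : ℝ) - θ * E.card ≤ -L),
        p ^ E.card ≤ (n : ℝ) ^ (-L) * ((n : ℝ) ^ S.card)⁻¹ := by
      intro E hE
      rw [Finset.mem_filter] at hE
      calc p ^ E.card ≤ ((n : ℝ) ^ (-θ)) ^ E.card := pow_le_pow_left₀ hp0.le hp _
        _ = (n : ℝ) ^ (-θ * E.card) := by rw [Real.rpow_mul hn0.le, Real.rpow_natCast]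
        _ ≤ (n : ℝ) ^ (-L + -(S.card : ℝ)) := Real.rpow_le_rpow_of_exponent_le hn1 (by linarith [hE.2])
        _ = _ := by rw [Real.rpow_add hn0, Real.rpow_neg hn0.le (S.card : ℝ), Real.rpow_natCast]
    refine (Finset.sum_le_card_nsmul _ _ _ h3).trans ?_
    rw [nsmul_eq_mul]
    refine mul_le_mul_of_nonneg_right ?_ (by positivity)
    have h4 : ((R S).powerset.filter (fun E => (S.card : ℝ) - θ * E.card ≤ -L)).card
        ≤ 2 ^ ((m + W.ncard + 1) ^ 2) := by
      refine (Finset.card_filter_le _ _).trans ?_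
      rw [Finset.card_powerset]
      exact Nat.pow_le_pow_right (by norm_num) (hR S hSm)
    exact_mod_cast h4
  refine (Finset.sum_le_sum h2).trans ?_
  rw [← Finset.mul_sum, ← Finset.mul_sum]
  have h5 : ∑ S ∈ I1, ((n : ℝ) ^ S.card)⁻¹ ≤ (m + 1 : ℕ) := by
    rw [Finset.sum_biUnion (fun s _ t _ hst => Finset.pairwise_disjoint_powersetCard _ hst)]
    have : ∀ s ∈ Finset.range (m + 1), ∑ S ∈ Finset.powersetCard s (Finset.univ : Finset (Fin n)),
        ((n : ℝ) ^ S.card)⁻¹ ≤ 1 := by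
      intro s _
      rw [Finset.sum_congr rfl (g := fun _ => ((n : ℝ) ^ s)⁻¹)
        (fun S hS => by rw [(Finset.mem_powersetCard.1 hS).2])]
      rw [Finset.sum_const, Finset.card_powersetCard, nsmul_eq_mul, Finset.card_univ,
        Fintype.card_fin, ← div_eq_mul_inv, div_le_one (by positivity)]
      exact_mod_cast Nat.choose_le_pow n s
    refine (Finset.sum_le_card_nsmul _ _ _ this).trans ?_
    simp
  calc (2 : ℝ) ^ ((m + W.ncard + 1) ^ 2) * ((n : ℝ) ^ (-L) * ∑ S ∈ I1, ((n : ℝ) ^ S.card)⁻¹)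
      ≤ (2 : ℝ) ^ ((m + W.ncard + 1) ^ 2) * ((n : ℝ) ^ (-L) * (m + 1 : ℕ)) := by gcongr
    _ = _ := by push_cast; ring

/-- Lemma 4.5: for strictly balanced `[W,Z]` and `p ≤ n^{-1/d(W,Z)+ϖ}`,
`τ - σ` is bounded except with polynomially small probability. -/
theorem stmt13 {β : Type*} [Fintype β] (F : SimpleGraph β) (W Z : Set β) (hWZ : W ⊂ Z)
    (he : 1 ≤ eWZ F W Z) (hbal : StrictlyBalancedWZ F W Z) :
    ∃ ϖ : ℝ, 0 < ϖ ∧ ∀ D : ℝ, 0 < D → ∃ C : ℕ, 0 < C ∧ ∃ N : ℕ, ∀ n ≥ N,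
      ∀ p ∈ Set.Ioc (0 : ℝ) 1, p ≤ (n : ℝ) ^ (-(1 / dWZ F W Z) + ϖ) →
        ∀ x : ↥W → Fin n, Function.Injective x →
          erProb n p {G | sigmaExt F W Z G x + C < tauExt F W Z G x}
            < (n : ℝ) ^ (-D) := by
  obtain ⟨δ, hδ, hδ1, hδ2⟩ := exists_gap F W Z hWZ he hbal
  have heR : (1 : ℝ) ≤ eWZ F W Z := by exact_mod_cast he
  set e : ℝ := (eWZ F W Z : ℝ) with hedef
  have hd : 0 < dWZ F W Z := by
    by_contra hcon
    have : 1 / dWZ F W Z ≤ 0 := div_nonpos_of_nonneg_of_nonpos zero_le_one (not_lt.1 hcon)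
    linarith
  set r : ℝ := 1 / dWZ F W Z with hr
  have hϖ : 0 < δ / (4 * e) := by positivity
  set ϖ : ℝ := δ / (4 * e) with hϖdef
  have hϖe : ϖ * e = δ / 4 := by
    rw [hϖdef]
    field_simp
  have hϖle : ϖ ≤ δ / 4 := by nlinarith
  refine ⟨ϖ, hϖ, fun D hD => ?_⟩
  obtain ⟨K, hK⟩ := exists_nat_ge ((D + 1) / (δ / 2))
  rw [div_le_iff₀ (by positivity)] at hK
  set m := 2 * vWZ W Z * K with hm
  set Q : ℕ := (m + 1) * 2 ^ ((m + W.ncard + 1) ^ 2) with hQ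
  refine ⟨2 ^ m * 2 ^ ((m + W.ncard + 1) ^ 2), by positivity, Q + 1, ?_⟩
  intro n hn p hp hple x _
  have hn1 : 1 ≤ n := by omega
  have hn0 : (0 : ℝ) < n := by exact_mod_cast hn1
  have key := prob_part (L := D + 1) (θ := r - ϖ) hn1 hp.1 hp.2
    (by rw [neg_sub, sub_eq_neg_add]; exact hple) x m
    (A := {G | sigmaExt F W Z G x + 2 ^ m * 2 ^ ((m + W.ncard + 1) ^ 2) < tauExt F W Z G x}) (by
      intro G hG
      obtain ⟨S, E, hI, h1, h2⟩ := determ (θ := r - ϖ) (ε := 3 * δ / 4) (η := δ / 4) hWZ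
        (by linarith) (by
          intro Y h1 h2
          have h3 := hδ2 Y h1 h2
          have h4 : (eWZ F Y Z : ℝ) ≤ e := by
            have := e_add F h1.1 h2.1
            have h5 : eWZ F Y Z ≤ eWZ F W Z := by omega
            exact Nat.cast_le.2 h5
          nlinarith) (by positivity) (by
          have e2 : (vWZ W Z : ℝ) = r * e := by
            rw [hr, hedef]
            unfold dWZ
            have : (eWZ F W Z : ℝ) ≠ 0 := by positivity
            field_simp
          rw [e2, ← hedef]
          nlinarith) (by positivity) K hG K le_rfl
      refine ⟨S, E, hI, h1, h2.trans ?_⟩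
      linarith)
  refine key.trans_lt ?_
  have h1 : (n : ℝ) ^ (-D) = n * (n : ℝ) ^ (-(D + 1)) := by
    rw [← Real.rpow_one_add' hn0.le (by linarith)]
    congr 1
    ring
  rw [h1]
  refine mul_lt_mul_of_pos_right ?_ (Real.rpow_pos_of_pos hn0 _)
  exact_mod_cast hn

end RG
end
end
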